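/- Let D be the class of all finite simple graphs with maximum degree at most 3. Then for every nonnegative integer r, the expansion of D satisfies Ex_D(r) = (3/2)·2^r. -/

import Mathlib

open SimpleGraph ENNReal

universe u

/-- `H` is a shallow minor of `G` at depth `r`: there are pairwise disjoint branch sets
`A i ⊆ V(G)`, each inducing a connected subgraph of radius at most `r` (witnessed by a
center joined to every vertex of the branch set by a walk of length at most `r` inside it),
such that adjacency in `H` is witnessed by an edge of `G` between the branch sets. -/
def SimpleGraph.IsShallowMinor {V : Type u} (G : SimpleGraph V) (r : ℕ)
    {h : ℕ} (H : SimpleGraph (Fin h)) : Prop :=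
  ∃ A : Fin h → Set V,
    (Pairwise fun i j => Disjoint (A i) (A j)) ∧
    (∀ i, ∃ c : A i, ∀ v : A i, ∃ w : (G.induce (A i)).Walk c v, w.length ≤ r) ∧
    (∀ i j, H.Adj i j → ∃ a ∈ A i, ∃ b ∈ A j, G.Adj a b)

/-- The grad (greatest reduced average density) `∇_r(G)`: supremum of `‖H‖/|H|` over the
shallow minors `H` of `G` at depth `r`. -/
noncomputable def SimpleGraph.nabla {V : Type u} (G : SimpleGraph V) (r : ℕ) : ℝ≥0∞ :=
  sSup {x : ℝ≥0∞ | ∃ (h : ℕ) (H : SimpleGraph (Fin h)), 0 < h ∧ G.IsShallowMinor r H ∧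
    x = (Nat.card H.edgeSet : ℝ≥0∞) / (h : ℝ≥0∞)}

/-- A class of finite simple graphs, presented as a set of graphs on `Fin n` for varying `n`. -/
abbrev GraphClass : Type := Set ((n : ℕ) × SimpleGraph (Fin n))

/-- The expansion `Ex_C(r) = sup { ∇_r(G) : G ∈ C }` of a class of graphs. -/
noncomputable def GraphClass.expansion (C : GraphClass) (r : ℕ) : ℝ≥0∞ :=
  sSup {x : ℝ≥0∞ | ∃ G ∈ C, x = SimpleGraph.nabla G.2 r}

/-- Iterated deletion of internal vertices of long induced-degree-two paths, ending in a
forest.  `PathDegen G p H` means the subgraph `H` of `G` can be reduced to a forest by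
repeatedly deleting the internal vertices (all of degree two) of a path of length at
least `p`. -/
inductive SimpleGraph.PathDegen {V : Type u} (G : SimpleGraph V) (p : ℕ) : G.Subgraph → Prop
  | forest (H : G.Subgraph) (hH : H.coe.IsAcyclic) : PathDegen G p H
  | step (H : G.Subgraph) (l : List V) (hnd : l.Nodup)
      (hchain : l.Chain' H.Adj) (hlen : p + 1 ≤ l.length)
      (hdeg : ∀ v ∈ l.tail.dropLast, (H.neighborSet v).ncard = 2)
      (hrec : PathDegen G p (H.deleteVerts {v | v ∈ l.tail.dropLast})) :
      PathDegen G p H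

/-- A graph is `p`-path degenerate if it can be reduced to a forest by repeatedly deleting
the internal vertices, all of degree two, of paths of length at least `p`. -/
def SimpleGraph.IsPathDegenerate {V : Type u} (G : SimpleGraph V) (p : ℕ) : Prop :=
  G.PathDegen p ⊤

/-- A circular `(n,k)`-coloring: a map to `ℤ_n` sending adjacent vertices to elements at
circular distance at least `k`. -/
def SimpleGraph.IsCircularColoring {V : Type u} (G : SimpleGraph V) (n k : ℕ) : Prop :=
  ∃ f : V → ZMod n, ∀ u v, G.Adj u v → k ≤ (f u - f v).val ∧ (f u - f v).val ≤ n - k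

/-- The circular chromatic number: the infimum of the rationals `n/k` such that `G` has a
circular `(n,k)`-coloring. -/
noncomputable def SimpleGraph.circChromNum {V : Type u} (G : SimpleGraph V) : ℝ :=
  sInf {x : ℝ | ∃ n k : ℕ, 0 < n ∧ 0 < k ∧ G.IsCircularColoring n k ∧ x = (n : ℝ) / (k : ℝ)}

/-- `o` is an orientation of `G`: every arc of `o` is an edge of `G`, and every edge of `G`
gets exactly one of its two possible directions. -/
def SimpleGraph.IsOrientation {V : Type u} (G : SimpleGraph V) (o : V → V → Prop) : Prop :=
  (∀ u v, o u v → G.Adj u v) ∧ (∀ u v, G.Adj u v → (o u v ↔ ¬ o v u))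

/-- The oriented chromatic number: the least `k` such that every orientation of `G` admits a
homomorphism into some loopless digraph on `k` vertices. -/
noncomputable def SimpleGraph.orientedChromNum {V : Type u} (G : SimpleGraph V) : ℕ :=
  sInf {k : ℕ | ∀ o : V → V → Prop, G.IsOrientation o →
    ∃ D : Fin k → Fin k → Prop, Irreflexive D ∧
      ∃ f : V → Fin k, ∀ u v, o u v → D (f u) (f v)}

/-- The circulant digraph `C⃗_n^d`: vertex set `ℤ_n`, with an arc `(i,j)` whenever
`j - i ∈ {1, …, d}` (mod `n`). -/
def circulantDigraph (n d : ℕ) : ZMod n → ZMod n → Prop :=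
  fun i j => ∃ s : ℕ, 1 ≤ s ∧ s ≤ d ∧ j - i = (s : ZMod n)

/-- Tree-depth of `G`: the minimum height of a rooted forest (encoded as a strict partial
order on the vertices in which the set of strict ancestors of any vertex is a chain) all of
whose chains have at most `k` vertices, such that every edge of `G` joins two comparable
vertices. -/
noncomputable def SimpleGraph.treeDepth {V : Type u} [Fintype V] (G : SimpleGraph V) : ℕ :=
  sInf {k : ℕ | ∃ lt : V → V → Prop, Transitive lt ∧ Irreflexive lt ∧
    (∀ x y z, lt x z → lt y z → (lt x y ∨ lt y x ∨ x = y)) ∧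
    (∀ u v, G.Adj u v → lt u v ∨ lt v u) ∧
    (∀ s : Finset V, (∀ x ∈ s, ∀ y ∈ s, x = y ∨ lt x y ∨ lt y x) → s.card ≤ k)}

/-- The `p`-th chromatic number `χ_p(G)`: the least `N` such that `G` has a vertex coloring
with `N` colors in which, for every `i ≤ p`, the union of any `i` color classes induces a
subgraph of tree-depth at most `i`. -/
noncomputable def SimpleGraph.chiP {V : Type u} [Fintype V] (G : SimpleGraph V) (p : ℕ) : ℕ :=
  sInf {N : ℕ | ∃ c : V → Fin N, ∀ i : ℕ, i ≤ p → ∀ s : Finset (Fin N), s.card = i →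
    (G.induce {v | c v ∈ s}).treeDepth ≤ i}

/-- A `p`-centered coloring: every connected induced subgraph either has a color appearing
exactly once in it, or receives at least `p` distinct colors. -/
def SimpleGraph.IsCenteredColoring {V : Type u} (G : SimpleGraph V) (p : ℕ)
    {N : ℕ} (c : V → Fin N) : Prop :=
  ∀ s : Set V, (G.induce s).Connected →
    (∃ col : Fin N, {v ∈ s | c v = col}.ncard = 1) ∨ p ≤ (c '' s).ncard

/-- `H` is a minor of `G`: there are pairwise disjoint branch sets, each inducing a
connected subgraph of `G`, such that adjacency in `H` is witnessed by an edge of `G`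
between the corresponding branch sets. -/
def SimpleGraph.IsMinor {V : Type u} (G : SimpleGraph V) {h : ℕ} (H : SimpleGraph (Fin h)) : Prop :=
  ∃ A : Fin h → Set V,
    (Pairwise fun i j => Disjoint (A i) (A j)) ∧
    (∀ i, (G.induce (A i)).Connected) ∧
    (∀ i j, H.Adj i j → ∃ a ∈ A i, ∃ b ∈ A j, G.Adj a b)

/-- A minor-closed class of graphs. -/
def GraphClass.MinorClosed (C : GraphClass) : Prop :=
  ∀ G ∈ C, ∀ (h : ℕ) (H : SimpleGraph (Fin h)), (Sigma.snd G).IsMinor H → ⟨h, H⟩ ∈ C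

/-- The clique-grad `ω_r(G)`: the maximum clique number over the shallow minors of `G`
at depth `r`. -/
noncomputable def SimpleGraph.omegaMinor {V : Type u} (G : SimpleGraph V) (r : ℕ) : ℕ :=
  sSup {k : ℕ | ∃ (h : ℕ) (H : SimpleGraph (Fin h)), G.IsShallowMinor r H ∧
    ∃ s : Finset (Fin h), H.IsNClique k s}

namespace SimpleGraph

section UpperBound

variable {V : Type*} [Fintype V] [DecidableEq V] (G : SimpleGraph V) [DecidableRel G.Adj]

/-- The darts of `G` leaving a finite set of vertices. -/
def outDarts (S : Finset V) : Finset (V × V) :=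
  {p | p.1 ∈ S ∧ p.2 ∉ S ∧ G.Adj p.1 p.2}

variable {G}

theorem mem_outDarts {S : Finset V} {p : V × V} :
    p ∈ G.outDarts S ↔ p.1 ∈ S ∧ p.2 ∉ S ∧ G.Adj p.1 p.2 := by
  simp [outDarts]

theorem card_outDarts_singleton_le {d : ℕ} (hG : ∀ v, G.degree v ≤ d) (c : V) :
    (G.outDarts {c}).card ≤ d := by
  refine le_trans (Finset.card_le_card_of_injOn (t := G.neighborFinset c) Prod.snd ?_ ?_) (hG c)
  · rintro ⟨a, b⟩ h
    rw [Finset.mem_coe, mem_outDarts] at h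
    obtain ⟨h1, -, h3⟩ := h
    simp only [Finset.mem_singleton] at h1
    simpa [← h1] using h3
  · rintro ⟨a, b⟩ h ⟨a', b'⟩ h' hb
    rw [Finset.mem_coe, mem_outDarts] at h h'
    simp only [Finset.mem_singleton] at h h'
    exact Prod.ext (h.1.trans h'.1.symm) hb

/-- Enlarging a set by some of its neighbours multiplies the number of outgoing darts by at most
the maximum degree minus one. -/
theorem card_outDarts_le_mul {d : ℕ} (hd : 1 ≤ d) (hG : ∀ v, G.degree v ≤ d + 1)
    {S T : Finset V} (hST : S ⊆ T) (hT : ∀ v ∈ T, v ∉ S → ∃ u ∈ S, G.Adj u v) :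
    (G.outDarts T).card ≤ d * (G.outDarts S).card := by
  have key : ∀ v, ∃ u, v ∈ T → v ∉ S → u ∈ S ∧ G.Adj u v := by
    intro v
    by_cases h : v ∈ T ∧ v ∉ S
    · obtain ⟨u, hu⟩ := hT v h.1 h.2
      exact ⟨u, fun _ _ => hu⟩
    · exact ⟨v, fun h1 h2 => absurd ⟨h1, h2⟩ h⟩
  choose p hp using key
  refine Finset.card_le_mul_card_image_of_maps_to
    (f := fun q : V × V => if q.1 ∈ S then q else (p q.1, q.1)) ?_ d ?_
  · rintro ⟨a, b⟩ h
    obtain ⟨h1, h2, h3⟩ := mem_outDarts.1 h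
    by_cases ha : a ∈ S
    · simpa [ha, mem_outDarts] using ⟨fun hb => h2 (hST hb), h3⟩
    · simpa [ha, mem_outDarts] using hp a h1 ha
  · rintro ⟨x, y⟩ hxy
    obtain ⟨hx, hy, hadj⟩ := mem_outDarts.1 hxy
    by_cases hyT : y ∈ T
    · have hcard : ((G.neighborFinset y).erase x).card ≤ d := by
        rw [Finset.card_erase_of_mem (by simpa using hadj.symm), card_neighborFinset_eq_degree]
        have := hG y
        omega
      refine le_trans (Finset.card_le_card_of_injOn Prod.snd ?_ ?_) hcard
      · rintro ⟨a, b⟩ h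
        simp only [Finset.coe_filter, Set.mem_ofPred_eq, mem_outDarts] at h
        obtain ⟨⟨h1, h2, h3⟩, h4⟩ := h
        split_ifs at h4 with ha
        · simp only [Prod.mk.injEq] at h4
          exact absurd (h4.2 ▸ hyT) h2
        · simp only [Prod.mk.injEq] at h4
          have hb : b ≠ x := fun hb => h2 (hST (hb ▸ hx))
          simpa [hb] using h4.2 ▸ h3
      · rintro ⟨a, b⟩ h ⟨a', b'⟩ h' hb
        simp only [Finset.coe_filter, Set.mem_ofPred_eq, mem_outDarts] at h h'
        have aux : ∀ a b : V, b ∉ T → (if a ∈ S then (a, b) else (p a, a)) = (x, y) → a = y := by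
          intro a b hbT h
          split_ifs at h with ha
          · simp only [Prod.mk.injEq] at h
            exact absurd (h.2 ▸ hyT) hbT
          · exact (Prod.mk.inj h).2
        exact Prod.ext ((aux a b h.1.2.1 h.2).trans (aux a' b' h'.1.2.1 h'.2).symm) hb
    · refine le_trans (Finset.card_le_one.2 ?_) hd
      have aux : ∀ q ∈ (G.outDarts T).filter
          (fun q => (if q.1 ∈ S then q else (p q.1, q.1)) = (x, y)), q = (x, y) := by
        intro q h
        simp only [Finset.mem_filter, mem_outDarts] at h
        obtain ⟨⟨h1, -, -⟩, h4⟩ := h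
        split_ifs at h4 with ha
        · exact h4
        · exact absurd ((Prod.mk.inj h4).2 ▸ h1) hyT
      intro q hq q' hq'
      rw [aux q hq, aux q' hq']

/-- Few darts leave the set of vertices reachable from `c` by short walks inside `A`. -/
theorem card_outDarts_ball_le {d : ℕ} (hd : 1 ≤ d) (hG : ∀ v, G.degree v ≤ d + 1)
    {A : Set V} (c : A) (k : ℕ) (S : Finset V)
    (hS : ∀ v, v ∈ S ↔ ∃ hv : v ∈ A, ∃ w : (G.induce A).Walk c ⟨v, hv⟩, w.length ≤ k) :
    (G.outDarts S).card ≤ (d + 1) * d ^ k := by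
  classical
  induction k generalizing S with
  | zero =>
    have : S = {(c : V)} := by
      ext v
      rw [hS, Finset.mem_singleton]
      constructor
      · rintro ⟨hv, w, hw⟩
        exact congrArg Subtype.val (Walk.eq_of_length_eq_zero (Nat.le_zero.1 hw)).symm
      · rintro rfl
        exact ⟨c.2, Walk.nil, le_rfl⟩
    simpa [this] using card_outDarts_singleton_le hG (c : V)
  | succ k ih =>
    let S' : Finset V :=
      {v | ∃ hv : v ∈ A, ∃ w : (G.induce A).Walk c ⟨v, hv⟩, w.length ≤ k}
    have hS' : ∀ v, v ∈ S' ↔ ∃ hv : v ∈ A, ∃ w : (G.induce A).Walk c ⟨v, hv⟩, w.length ≤ k := by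
      intro v
      simp [S']
    have hsub : S' ⊆ S := by
      intro v hv
      obtain ⟨h, w, hw⟩ := (hS' v).1 hv
      exact (hS v).2 ⟨h, w, hw.trans k.le_succ⟩
    have hstep : ∀ v ∈ S, v ∉ S' → ∃ u ∈ S', G.Adj u v := by
      intro v hv hv'
      obtain ⟨h, w, hw⟩ := (hS v).1 hv
      have hnil : ¬ w.Nil := by
        intro hn
        refine hv' ((hS' v).2 ⟨h, w, ?_⟩)
        rw [Walk.length_eq_zero_iff.2 hn]
        exact k.zero_le
      refine ⟨w.penultimate, (hS' _).2 ⟨w.penultimate.2, w.dropLast, ?_⟩, ?_⟩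
      · rw [Walk.length_dropLast]
        omega
      · simpa using w.adj_penultimate hnil
    calc (G.outDarts S).card ≤ d * (G.outDarts S').card := card_outDarts_le_mul hd hG hsub hstep
      _ ≤ d * ((d + 1) * d ^ k) := Nat.mul_le_mul_left _ (ih S' hS')
      _ = (d + 1) * d ^ (k + 1) := by ring

theorem IsShallowMinor.degree_le {V : Type u} [Fintype V] [DecidableEq V] {G : SimpleGraph V}
    [DecidableRel G.Adj] {r d h : ℕ} {H : SimpleGraph (Fin h)} [DecidableRel H.Adj]
    (hd : 1 ≤ d) (hG : ∀ v, G.degree v ≤ d + 1) (hH : G.IsShallowMinor r H) (i : Fin h) :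
    H.degree i ≤ (d + 1) * d ^ r := by
  classical
  obtain ⟨A, hdisj, hrad, hadj⟩ := hH
  obtain ⟨c, hc⟩ := hrad i
  refine le_trans ?_ (card_outDarts_ball_le hd hG c r (A i).toFinset fun v => ?_)
  · have key : ∀ j, ∃ q : V × V, H.Adj i j → q.1 ∈ A i ∧ q.2 ∈ A j ∧ G.Adj q.1 q.2 := by
      intro j
      by_cases h : H.Adj i j
      · obtain ⟨a, ha, b, hb, hab⟩ := hadj i j h
        exact ⟨(a, b), fun _ => ⟨ha, hb, hab⟩⟩
      · exact ⟨(c, c), fun h' => absurd h' h⟩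
    choose q hq using key
    rw [← card_neighborFinset_eq_degree]
    refine Finset.card_le_card_of_injOn q ?_ ?_
    · intro j hj
      have hij : H.Adj i j := by simpa using hj
      obtain ⟨h1, h2, h3⟩ := hq j hij
      rw [Finset.mem_coe, mem_outDarts]
      refine ⟨by simpa using h1, ?_, h3⟩
      simpa using fun h => Set.disjoint_left.1 (hdisj hij.ne) h h2
    · intro j hj j' hj' heq
      have hij : H.Adj i j := by simpa using hj
      have hij' : H.Adj i j' := by simpa using hj'
      by_contra hne
      exact Set.disjoint_left.1 (hdisj hne) (hq j hij).2.1 (heq ▸ (hq j' hij').2.1)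
  · rw [Set.mem_toFinset]
    exact ⟨fun hv => ⟨hv, hc ⟨v, hv⟩⟩, fun ⟨hv, _⟩ => hv⟩

end UpperBound

theorem nabla_le {V : Type u} [Finite V] {G : SimpleGraph V} {d : ℕ} (hd : 1 ≤ d)
    (hG : ∀ v, (G.neighborSet v).ncard ≤ d + 1) (r : ℕ) :
    G.nabla r ≤ (((d + 1) * d ^ r : ℕ) : ℝ≥0∞) / 2 := by
  classical
  have := Fintype.ofFinite V
  refine sSup_le ?_
  rintro x ⟨h, H, hpos, hH, rfl⟩
  have hG' : ∀ v, G.degree v ≤ d + 1 := fun v => by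
    rw [← card_neighborFinset_eq_degree, neighborFinset_def, ← Set.ncard_eq_toFinset_card']
    exact hG v
  have hsum : 2 * Nat.card H.edgeSet ≤ h * ((d + 1) * d ^ r) := by
    rw [Nat.card_eq_fintype_card, ← edgeFinset_card, ← sum_degrees_eq_twice_card_edges]
    simpa using Finset.sum_le_card_nsmul Finset.univ _ _ fun i _ => hH.degree_le hd hG' i
  have h0 : (h : ℝ≥0∞) ≠ 0 := by exact_mod_cast hpos.ne'
  rw [ENNReal.div_le_iff h0 (ENNReal.natCast_ne_top h), ← ENNReal.mul_div_right_comm,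
    ENNReal.le_div_iff_mul_le (by simp) (by simp), mul_comm, mul_comm _ (h : ℝ≥0∞)]
  exact_mod_cast hsum

section LowerBound

/-- The parent function of the infinite rooted tree on `ℕ` with root `0`, in which `0` has the
children `1, 2, 3` and every other `m` has the children `2 * m + 2, 2 * m + 3`.
The first `3 * 2 ^ k - 2` numbers are the vertices of depth at most `k`. -/
def treeParent (m : ℕ) : ℕ := m / 2 - 1

/-- For fixed `i`, an injection of the indices `j ≠ i` below `n + 1` into the numbers
below `n`. -/
def slot (i j : ℕ) : ℕ := if j < i then j else j - 1

theorem treeParent_slot_lt {r i j : ℕ} (hi : i < 3 * 2 ^ r + 1) (hj : j < 3 * 2 ^ r + 1) :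
    treeParent (3 * 2 ^ r - 2 + slot i j) < 3 * 2 ^ r - 2 := by
  have := Nat.one_le_two_pow (n := r)
  unfold treeParent slot
  split_ifs <;> omega

/-- The complete graph on `3 * 2 ^ r + 1` vertices, with each vertex expanded to a tree of depth
`r` and the edges distributed among the leaves, so that all degrees are at most three. -/
def treeBlowup (r : ℕ) : SimpleGraph (Fin (3 * 2 ^ r + 1) × Fin (3 * 2 ^ r - 2)) where
  Adj x y :=
    (x.1 = y.1 ∧ ((x.2.val ≠ 0 ∧ treeParent x.2 = y.2) ∨ (y.2.val ≠ 0 ∧ treeParent y.2 = x.2))) ∨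
    (x.1 ≠ y.1 ∧ treeParent (3 * 2 ^ r - 2 + slot x.1 y.1) = x.2 ∧
      treeParent (3 * 2 ^ r - 2 + slot y.1 x.1) = y.2)
  symm := ⟨by
    rintro x y (⟨h, h'⟩ | ⟨h, h1, h2⟩)
    · exact Or.inl ⟨h.symm, h'.symm⟩
    · exact Or.inr ⟨h.symm, h2, h1⟩⟩
  loopless := ⟨by
    rintro x (⟨-, h⟩ | ⟨h, -⟩)
    · simp only [treeParent] at h
      omega
    · exact h rfl⟩

theorem ncard_tree_neighbors_le (a : ℕ) :
    {m : ℕ | (m ≠ 0 ∧ treeParent m = a) ∨ (a ≠ 0 ∧ treeParent a = m)}.ncard ≤ 3 := by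
  let t : Finset ℕ := if a = 0 then {1, 2, 3} else {a / 2 - 1, 2 * a + 2, 2 * a + 3}
  have ht : t.card ≤ 3 := by
    unfold t
    split_ifs
    · exact Finset.card_le_three
    · exact Finset.card_le_three
  refine le_trans (Set.ncard_le_ncard (t := (t : Set ℕ)) ?_ t.finite_toSet) ?_
  · intro m hm
    simp only [Set.mem_ofPred_eq, treeParent] at hm
    unfold t
    split_ifs <;> simp only [Finset.coe_insert, Finset.coe_singleton, Set.mem_insert_iff,
      Set.mem_singleton_iff] <;> omega
  · rwa [Set.ncard_coe_finset]

theorem treeBlowup_ncard_neighborSet_le (r : ℕ)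
    (x : Fin (3 * 2 ^ r + 1) × Fin (3 * 2 ^ r - 2)) :
    ((treeBlowup r).neighborSet x).ncard ≤ 3 := by
  have hfin : {m : ℕ | (m ≠ 0 ∧ treeParent m = x.2) ∨
      (x.2.val ≠ 0 ∧ treeParent x.2 = m)}.Finite := by
    refine (Set.finite_Iio (2 * x.2.val + 4)).subset fun m hm => ?_
    simp only [Set.mem_ofPred_eq, treeParent, Set.mem_Iio] at hm ⊢
    omega
  refine le_trans (Set.ncard_le_ncard_of_injOn
    (fun y => if x.1 = y.1 then y.2.val else 3 * 2 ^ r - 2 + slot x.1 y.1) ?_ ?_ hfin)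
    (ncard_tree_neighbors_le x.2)
  · intro y hy
    simp only [mem_neighborSet, treeBlowup] at hy
    simp only [Set.mem_ofPred_eq]
    have := x.2.isLt
    split_ifs with h
    · tauto
    · exact Or.inl ⟨by omega, by tauto⟩
  · rintro ⟨i, a⟩ hy ⟨j, b⟩ hz heq
    obtain ⟨k, c⟩ := x
    simp only [mem_neighborSet, treeBlowup, Fin.ext_iff] at hy hz
    simp only [Fin.ext_iff] at heq
    have ha := a.isLt
    have hb := b.isLt
    have hij : i.val = j.val := by
      unfold slot at heq
      split_ifs at heq <;> omega
    obtain rfl : i = j := Fin.ext hij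
    refine Prod.ext rfl (Fin.ext ?_)
    change a.val = b.val
    by_cases h : k.val = i.val
    · simpa [h] using heq
    · have h1 := hy.resolve_left fun h' => h h'.1
      have h2 := hz.resolve_left fun h' => h h'.1
      exact h1.2.2.symm.trans h2.2.2

theorem treeBlowup_comap_isShallowMinor_top {V : Type u} (r : ℕ)
    (e : V ≃ Fin (3 * 2 ^ r + 1) × Fin (3 * 2 ^ r - 2)) :
    ((treeBlowup r).comap e).IsShallowMinor r (⊤ : SimpleGraph (Fin (3 * 2 ^ r + 1))) := by
  have hN : 0 < 3 * 2 ^ r - 2 := by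
    have := Nat.one_le_two_pow (n := r)
    omega
  refine ⟨fun i => {v | (e v).1 = i}, ?_, ?_, ?_⟩
  · intro i j hij
    exact Set.disjoint_left.2 fun v hi hj => hij (hi.symm.trans hj)
  · intro i
    refine ⟨⟨e.symm (i, ⟨0, hN⟩), by simp⟩, ?_⟩
    suffices h : ∀ k (a : Fin (3 * 2 ^ r - 2)), a.val < 3 * 2 ^ k - 2 →
        ∃ w : (((treeBlowup r).comap e).induce {v | (e v).1 = i}).Walk
          ⟨e.symm (i, ⟨0, hN⟩), by simp⟩ ⟨e.symm (i, a), by simp⟩, w.length ≤ k by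
      rintro ⟨v, hv⟩
      obtain ⟨w, hw⟩ := h r (e v).2 (e v).2.isLt
      have hev : e.symm (i, (e v).2) = v := by
        rw [← show (e v).1 = i from hv]
        simp
      have heq : (⟨e.symm (i, (e v).2), by simp⟩ : {v | (e v).1 = i}) = ⟨v, hv⟩ :=
        Subtype.ext hev
      exact ⟨w.copy rfl heq, (Walk.length_copy w rfl heq).trans_le hw⟩
    intro k
    induction k with
    | zero =>
      intro a ha
      obtain rfl : a = ⟨0, hN⟩ := Fin.ext (by simpa using ha)
      exact ⟨Walk.nil, le_rfl⟩
    | succ k ih =>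
      intro a ha
      by_cases ha0 : a.val = 0
      · obtain rfl : a = ⟨0, hN⟩ := Fin.ext ha0
        exact ⟨Walk.nil, Nat.zero_le _⟩
      · have hlt : treeParent a < 3 * 2 ^ k - 2 := by
          have := Nat.one_le_two_pow (n := k)
          rw [pow_succ] at ha
          unfold treeParent
          omega
        have hlt' : treeParent a < 3 * 2 ^ r - 2 := by
          have := a.isLt
          unfold treeParent
          omega
        obtain ⟨w, hw⟩ := ih ⟨treeParent a, hlt'⟩ hlt
        have hadj : (((treeBlowup r).comap e).induce {v | (e v).1 = i}).Adj
            ⟨e.symm (i, ⟨treeParent a, hlt'⟩), by simp⟩ ⟨e.symm (i, a), by simp⟩ := by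
          simp [treeBlowup, ha0]
        exact ⟨w.concat hadj, (w.length_concat hadj).trans_le (Nat.succ_le_succ hw)⟩
  · intro i j hij
    refine ⟨e.symm (i, ⟨_, treeParent_slot_lt i.isLt j.isLt⟩), by simp,
      e.symm (j, ⟨_, treeParent_slot_lt j.isLt i.isLt⟩), by simp, ?_⟩
    simp [treeBlowup, hij.ne]

end LowerBound

/-- A shallow minor that is complete on `d + 1` vertices forces grad at least `d / 2`. -/
theorem IsShallowMinor.le_nabla_of_top {V : Type u} {G : SimpleGraph V} {r d : ℕ}
    (h : G.IsShallowMinor r (⊤ : SimpleGraph (Fin (d + 1)))) :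
    (d : ℝ≥0∞) / 2 ≤ G.nabla r := by
  classical
  refine le_sSup ⟨d + 1, ⊤, d.succ_pos, h, ?_⟩
  have hcard : Nat.card (⊤ : SimpleGraph (Fin (d + 1))).edgeSet * 2 = d * (d + 1) := by
    rw [Nat.card_eq_fintype_card, ← edgeFinset_card, card_edgeFinset_top_eq_card_choose_two,
      Fintype.card_fin, Nat.choose_two_right,
      Nat.div_mul_cancel (Nat.even_mul_pred_self (d + 1)).two_dvd, Nat.add_sub_cancel, mul_comm]
  have h0 : ((d + 1 : ℕ) : ℝ≥0∞) ≠ 0 := by exact_mod_cast d.succ_ne_zero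
  rw [ENNReal.eq_div_iff h0 (ENNReal.natCast_ne_top _), ← mul_div_assoc, eq_comm,
    ENNReal.eq_div_iff (by simp) (by simp), mul_comm, mul_comm ((d + 1 : ℕ) : ℝ≥0∞)]
  exact_mod_cast hcard

end SimpleGraph

theorem expansion_maxDegree_three
    (r : ℕ) :
    GraphClass.expansion
      {G : (n : ℕ) × SimpleGraph (Fin n) | ∀ v, ((Sigma.snd G).neighborSet v).ncard ≤ 3} r
      = (3 / 2 : ℝ≥0∞) * 2 ^ r := by
  have hval : (((2 + 1) * 2 ^ r : ℕ) : ℝ≥0∞) / 2 = (3 / 2 : ℝ≥0∞) * 2 ^ r := by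
    push_cast
    rw [ENNReal.mul_div_right_comm]
  rw [← hval]
  refine le_antisymm (sSup_le ?_) ?_
  · rintro x ⟨G, hG, rfl⟩
    exact nabla_le one_le_two hG r
  · let e := (finProdFinEquiv (m := 3 * 2 ^ r + 1) (n := 3 * 2 ^ r - 2)).symm
    refine (treeBlowup_comap_isShallowMinor_top r e).le_nabla_of_top.trans
      (le_sSup ⟨⟨_, (treeBlowup r).comap e⟩, fun v => ?_, rfl⟩)
    refine le_trans (Set.ncard_le_ncard_of_injOn e ?_ e.injective.injOn)
      (treeBlowup_ncard_neighborSet_le r (e v))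
    exact fun w hw => hw
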